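/- arXiv:2602.03758 — 2 statements merged into one kernel-verified Lean document; each statement's English description precedes it below -/
import Mathlib

section
/- Let R be an infinite commutative ring and r ∈ ℕ. For any partition R = C₁ ∪ ... ∪ C_r, there exists s ∈ {1,...,r} such that for every finite set F of polynomials over R with zero constant term, the set {n ∈ R : ∩_{f∈F}(-f(n)+C_s) ≠ ∅} is an IP*-set in (R,+). Equivalently, for every such F, the set of n ∈ R for which there exists a ∈ R with a+f(n) ∈ C_s for all f ∈ F is IP*. -/
/-- `A` is an IP-set in `(S,+)`: it contains all finite sums of some sequence. -/
def IPSet {S : Type*} [AddCommMonoid S] (A : Set S) : Prop :=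
  ∃ x : ℕ → S, ∀ K : Finset ℕ, K.Nonempty → (∑ n ∈ K, x n) ∈ A

/-- `A` is an IP*-set: it meets every IP-set. -/
def IPStarSet {S : Type*} [AddCommMonoid S] (A : Set S) : Prop :=
  ∀ B : Set S, IPSet B → (A ∩ B).Nonempty

open Polynomial

universe u

section PolynomialRecurrence

variable {R : Type u} [CommRing R]

/-- The polynomial `n ↦ p (n + m) - p m - q n`. -/
noncomputable def shiftDiff (q p : R[X]) (m : R) : R[X] :=
  taylor m p - C (p.eval m) - q

lemma eval_shiftDiff (q p : R[X]) (m n : R) :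
    (shiftDiff q p m).eval n = p.eval (n + m) - p.eval m - q.eval n := by
  simp [shiftDiff, taylor_eval]

lemma coeff_zero_shiftDiff {q : R[X]} (p : R[X]) (m : R) (hq : q.coeff 0 = 0) :
    (shiftDiff q p m).coeff 0 = 0 := by
  simp [shiftDiff, taylor_coeff_zero, hq]

lemma shiftDiff_self_zero {q : R[X]} (hq : q.coeff 0 = 0) : shiftDiff q q 0 = 0 := by
  simp [shiftDiff, ← coeff_zero_eq_eval_zero, hq]

lemma natDegree_shiftDiff_le {q p : R[X]} (m : R) (h : q.natDegree ≤ p.natDegree) :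
    (shiftDiff q p m).natDegree ≤ p.natDegree := by
  refine (natDegree_sub_le_of_le (natDegree_sub_le_of_le (natDegree_taylor p m).le
    (natDegree_C _).le) h).trans ?_
  simp

lemma coeff_natDegree_shiftDiff (q : R[X]) {p : R[X]} (m : R) (hp : 0 < p.natDegree) :
    (shiftDiff q p m).coeff p.natDegree = p.leadingCoeff - q.coeff p.natDegree := by
  simp [shiftDiff, coeff_taylor_natDegree, coeff_C, hp.ne']

lemma natDegree_pos_of_coeff_zero {p : R[X]} (h0 : p.coeff 0 = 0) (hp : p ≠ 0) :
    0 < p.natDegree := by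
  rw [Nat.pos_iff_ne_zero]
  intro h
  apply hp
  rw [eq_C_of_natDegree_eq_zero h, h0, C_0]

/-- The leading data of `shiftDiff q p m`: unchanged if `p` has larger degree than `q`; shifted
by the leading coefficient of `q` if the degrees agree but the leading coefficients differ; and
otherwise of degree smaller than that of `q`. -/
lemma shiftDiff_leading {q p : R[X]} (m : R) (hq : 0 < q.natDegree)
    (h : q.natDegree ≤ p.natDegree) :
    (p.natDegree ≠ q.natDegree ∧ (shiftDiff q p m).natDegree = p.natDegree ∧
        (shiftDiff q p m).leadingCoeff = p.leadingCoeff) ∨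
      (p.natDegree = q.natDegree ∧ p.leadingCoeff ≠ q.leadingCoeff ∧
        (shiftDiff q p m).natDegree = p.natDegree ∧
        (shiftDiff q p m).leadingCoeff = p.leadingCoeff - q.leadingCoeff) ∨
      (shiftDiff q p m).natDegree < q.natDegree := by
  have hle := natDegree_shiftDiff_le m h
  have hco := coeff_natDegree_shiftDiff q m (hq.trans_le h)
  rcases h.lt_or_eq with hlt | heq
  · left
    rw [coeff_eq_zero_of_natDegree_lt hlt, sub_zero] at hco
    have hne : p.leadingCoeff ≠ 0 := by
      rw [Ne, leadingCoeff_eq_zero]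
      rintro rfl
      simp at hlt
    have hdeg := natDegree_eq_of_le_of_coeff_ne_zero hle (hco ▸ hne)
    exact ⟨hlt.ne', hdeg, by rw [leadingCoeff, hdeg, hco]⟩
  · right
    have hco' : (shiftDiff q p m).coeff p.natDegree = p.leadingCoeff - q.leadingCoeff := by
      rw [hco, ← heq, coeff_natDegree]
    by_cases hc : p.leadingCoeff = q.leadingCoeff
    · right
      rw [hc, sub_self] at hco'
      rw [heq]
      refine hle.lt_of_ne fun hd => ?_
      rw [← hd, coeff_natDegree, leadingCoeff_eq_zero] at hco'
      rw [hco'] at hd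
      simp only [natDegree_zero] at hd
      omega
    · left
      have hdeg := natDegree_eq_of_le_of_coeff_ne_zero hle (hco'.trans_ne (sub_ne_zero.2 hc))
      exact ⟨heq.symm, hc, hdeg, by rw [leadingCoeff, hdeg, hco']⟩

/-- Finitary polynomial van der Waerden property of a family `F` along the finite sums of `x`:
every finite coloring has a monochromatic configuration `a + f (∑ i ∈ K, x i)`, `f ∈ F`, inside a
finite set `Q`, where `K` is a nonempty subset of `[N, M)`, with `Q` and `M` independent of the
coloring. -/
def IPRecurrent (x : ℕ → R) (F : Finset R[X]) : Prop :=
  ∀ (κ : Type u) [Finite κ] (N : ℕ), ∃ (Q : Finset R) (M : ℕ), ∀ c : R → κ,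
    ∃ (a : R) (K : Finset ℕ), K ⊆ Finset.Ico N M ∧ K.Nonempty ∧
      ∃ s, ∀ f ∈ F, a + f.eval (∑ i ∈ K, x i) ∈ Q ∧ c (a + f.eval (∑ i ∈ K, x i)) = s

lemma IPRecurrent.mono {x : ℕ → R} {F G : Finset R[X]} (hG : IPRecurrent x G) (h : F ⊆ G) :
    IPRecurrent x F := by
  intro κ _ N
  obtain ⟨Q, M, H⟩ := hG κ N
  refine ⟨Q, M, fun c => ?_⟩
  obtain ⟨a, K, hK, hne, s, hs⟩ := H c
  exact ⟨a, K, hK, hne, s, fun f hf => hs f (h hf)⟩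

lemma ipRecurrent_singleton_zero (x : ℕ → R) : IPRecurrent x {0} := by
  intro κ _ N
  exact ⟨{0}, N + 1, fun c => ⟨0, {N}, by simp, by simp, c 0, by simp⟩⟩

open Classical in
/-- Color focusing: for each `t`, every finite coloring has a monochromatic configuration or `t`
monochromatic configurations of different colors focused at a common point `a`. -/
lemma exists_focused {x : ℕ → R} {G : Finset R[X]} {q : R[X]} (hq : q ∈ G)
    (hG : ∀ f ∈ G, f.coeff 0 = 0)
    (IH : ∀ D : Finset R, IPRecurrent x (Finset.image₂ (shiftDiff q) G D))
    (κ : Type u) [Finite κ] (N t : ℕ) :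
    ∃ (Q : Finset R) (M : ℕ), ∀ c : R → κ,
      (∃ (a : R) (K : Finset ℕ), K ⊆ Finset.Ico N M ∧ K.Nonempty ∧
        ∃ s, ∀ f ∈ insert 0 G,
          a + f.eval (∑ i ∈ K, x i) ∈ Q ∧ c (a + f.eval (∑ i ∈ K, x i)) = s) ∨
      ∃ a ∈ Q, ∃ S : Finset κ, S.card = t ∧ ∀ s ∈ S, ∃ K ⊆ Finset.Ico N M, K.Nonempty ∧
        ∀ f ∈ G, a + f.eval (∑ i ∈ K, x i) ∈ Q ∧ c (a + f.eval (∑ i ∈ K, x i)) = s := by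
  induction t with
  | zero => exact ⟨{0}, N, fun c => Or.inr ⟨0, by simp, ∅, by simp, by simp⟩⟩
  | succ t ih =>
    obtain ⟨Q, M, hQ⟩ := ih
    let sums (n : ℕ) : Finset R := (Finset.range n).powerset.image fun K => ∑ i ∈ K, x i
    have mem_sums {n : ℕ} {K : Finset ℕ} {k : ℕ} (hK : K ⊆ Finset.Ico k n) :
        ∑ i ∈ K, x i ∈ sums n :=
      Finset.mem_image_of_mem _ <| Finset.mem_powerset.2 fun i hi =>
        Finset.mem_range.2 (Finset.mem_Ico.1 (hK hi)).2
    have zero_mem_sums (n : ℕ) : (0 : R) ∈ sums n := by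
      simpa using mem_sums (Finset.empty_subset (Finset.Ico 0 n))
    obtain ⟨Q', M', hQ'⟩ := IH (sums M) (Q → κ) (max N M)
    let Q₁ : Finset R := Finset.image₂ (· + ·) Q Q'
    let Q₂ : Finset R := Finset.image₂ (fun y n => y - q.eval n) Q₁ (sums M')
    refine ⟨Q₁ ∪ Q₂, max M M', fun c => ?_⟩
    obtain ⟨b, L, hL, hLne, col, hcol⟩ := hQ' fun y z => c (z + y)
    have hshift {z : R} (hz : z ∈ Q) {p : R[X]} (hp : p ∈ G) {m : R} (hm : m ∈ sums M) :
        z + (b + (shiftDiff q p m).eval (∑ i ∈ L, x i)) ∈ Q₁ ∧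
          c (z + (b + (shiftDiff q p m).eval (∑ i ∈ L, x i))) = col ⟨z, hz⟩ := by
      obtain ⟨h1, h2⟩ := hcol _ (Finset.mem_image₂_of_mem hp hm)
      exact ⟨Finset.mem_image₂_of_mem hz h1, congrFun h2 ⟨z, hz⟩⟩
    have hbase {z : R} (hz : z ∈ Q) : z + b ∈ Q₁ ∧ c (z + b) = col ⟨z, hz⟩ := by
      simpa [shiftDiff_self_zero (hG q hq)] using hshift hz hq (zero_mem_sums M)
    have hmono : Finset.Ico N M ⊆ Finset.Ico N (max M M') :=
      Finset.Ico_subset_Ico_right (le_max_left _ _)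
    have hLN : L ⊆ Finset.Ico N (max M M') :=
      hL.trans (Finset.Ico_subset_Ico (le_max_left _ _) (le_max_right _ _))
    have hsuccess {a : R} {K : Finset ℕ} (hK : K ⊆ Finset.Ico N M) (hne : K.Nonempty) {s : κ}
        (hs : ∀ f ∈ insert 0 G, a + f.eval (∑ i ∈ K, x i) ∈ Q ∧
          c (a + f.eval (∑ i ∈ K, x i) + b) = s) :
        ∃ (a : R) (K : Finset ℕ), K ⊆ Finset.Ico N (max M M') ∧ K.Nonempty ∧
          ∃ s, ∀ f ∈ insert 0 G, a + f.eval (∑ i ∈ K, x i) ∈ Q₁ ∪ Q₂ ∧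
            c (a + f.eval (∑ i ∈ K, x i)) = s := by
      refine ⟨a + b, K, hK.trans hmono, hne, s, fun f hf => ?_⟩
      obtain ⟨h1, h2⟩ := hs f hf
      rw [add_right_comm]
      exact ⟨Finset.mem_union_left _ (hbase h1).1, h2⟩
    rcases hQ fun y => c (y + b) with ⟨a, K, hK, hne, s, hs⟩ | ⟨a, ha, S, hS, hfoc⟩
    · exact Or.inl (hsuccess hK hne hs)
    by_cases hmem : c (a + b) ∈ S
    · left
      obtain ⟨K, hK, hne, hs⟩ := hfoc _ hmem
      refine hsuccess hK hne (a := a) (s := c (a + b)) fun f hf => ?_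
      rcases Finset.mem_insert.1 hf with rfl | hf
      · simpa using ha
      · exact hs f hf
    · right
      refine ⟨a + b - q.eval (∑ i ∈ L, x i), ?_, insert (c (a + b)) S, ?_, ?_⟩
      · exact Finset.mem_union_right _ (Finset.mem_image₂_of_mem (hbase ha).1 (mem_sums hL))
      · rw [Finset.card_insert_of_notMem hmem, hS]
      intro s hs
      rcases Finset.mem_insert.1 hs with rfl | hs
      · refine ⟨L, hLN, hLne, fun f hf => ?_⟩
        obtain ⟨h1, h2⟩ := hshift ha hf (zero_mem_sums M)
        have heq : a + b - q.eval (∑ i ∈ L, x i) + f.eval (∑ i ∈ L, x i) =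
            a + (b + (shiftDiff q f 0).eval (∑ i ∈ L, x i)) := by
          rw [eval_shiftDiff, add_zero, ← coeff_zero_eq_eval_zero, hG f hf]; ring
        rw [heq]
        exact ⟨Finset.mem_union_left _ h1, h2.trans (hbase ha).2.symm⟩
      · obtain ⟨K, hK, hne, hfK⟩ := hfoc s hs
        refine ⟨K ∪ L, Finset.union_subset (hK.trans hmono) hLN, hne.inl, fun f hf => ?_⟩
        have hdisj : Disjoint K L := by
          refine Finset.disjoint_left.2 fun i hiK hiL => ?_
          have h1 := Finset.mem_Ico.1 (hK hiK)
          have h2 := Finset.mem_Ico.1 (hL hiL)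
          have := le_max_right N M
          omega
        obtain ⟨hfQ, hfc⟩ := hfK f hf
        obtain ⟨h1, h2⟩ := hshift hfQ hf (mem_sums hK)
        have heq : a + b - q.eval (∑ i ∈ L, x i) + f.eval (∑ i ∈ K ∪ L, x i) =
            a + f.eval (∑ i ∈ K, x i) +
              (b + (shiftDiff q f (∑ i ∈ K, x i)).eval (∑ i ∈ L, x i)) := by
          rw [eval_shiftDiff, Finset.sum_union hdisj, add_comm (∑ i ∈ K, x i)]; ring
        rw [heq]
        exact ⟨Finset.mem_union_left _ h1, h2.trans ((hbase hfQ).2.symm.trans hfc)⟩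

open Classical in
/-- The step of the PET induction. -/
lemma ipRecurrent_insert_zero {x : ℕ → R} {G : Finset R[X]} {q : R[X]} (hq : q ∈ G)
    (hG : ∀ f ∈ G, f.coeff 0 = 0)
    (IH : ∀ D : Finset R, IPRecurrent x (Finset.image₂ (shiftDiff q) G D)) :
    IPRecurrent x (insert 0 G) := by
  intro κ _ N
  have := Fintype.ofFinite κ
  obtain ⟨Q, M, H⟩ := exists_focused hq hG IH κ N (Fintype.card κ + 1)
  refine ⟨Q, M, fun c => ?_⟩
  rcases H c with h | ⟨a, -, S, hS, -⟩
  · exact h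
  · have := S.card_le_univ
    omega

open Classical in
/-- PET induction: `P` lists the degrees and leading coefficients occurring in `F`. -/
lemma ipRecurrent_of_leading_mem (x : ℕ → R) (P : Multiset (ℕ × R)) (F : Finset R[X])
    (hF : ∀ f ∈ F, f.coeff 0 = 0)
    (hP : ∀ f ∈ F, f ≠ 0 → (f.natDegree, f.leadingCoeff) ∈ P) : IPRecurrent x F := by
  induction hw : P.map Prod.fst using
    (Multiset.wellFounded_isDershowitzMannaLT (α := ℕ)).induction generalizing P F with
  | _ w ih =>
  subst hw
  let G := F.filter (· ≠ 0)
  have hFG : F ⊆ insert 0 G := by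
    intro f hf
    by_cases h : f = 0 <;> simp [G, h, hf]
  refine IPRecurrent.mono ?_ hFG
  rcases G.eq_empty_or_nonempty with hG | hG
  · rw [hG]
    exact ipRecurrent_singleton_zero x
  obtain ⟨q, hqG, hmin⟩ := G.exists_min_image natDegree hG
  have hG0 : ∀ f ∈ G, f.coeff 0 = 0 := fun f hf => hF f (Finset.mem_filter.1 hf).1
  have hGP : ∀ f ∈ G, (f.natDegree, f.leadingCoeff) ∈ P := fun f hf =>
    hP f (Finset.mem_filter.1 hf).1 (Finset.mem_filter.1 hf).2
  have hqpos := natDegree_pos_of_coeff_zero (hG0 q hqG) (Finset.mem_filter.1 hqG).2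
  refine ipRecurrent_insert_zero hqG hG0 fun D => ?_
  obtain ⟨P₀, rfl⟩ := Multiset.exists_cons_of_mem (hGP q hqG)
  let F' := Finset.image₂ (shiftDiff q) G D
  let low : Multiset (ℕ × R) :=
    (F'.filter fun f => f.natDegree < q.natDegree).val.map fun f => (f.natDegree, f.leadingCoeff)
  let shift : ℕ × R → ℕ × R := fun z =>
    (z.1, if z.1 = q.natDegree then z.2 - q.leadingCoeff else z.2)
  refine ih _ ?_ (P₀.map shift + low) F' ?_ ?_ rfl
  · refine ⟨P₀.map Prod.fst, low.map Prod.fst, {q.natDegree}, by simp, ?_, ?_, ?_⟩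
    · simp [shift]
    · simp [add_comm]
    · simp only [low, Multiset.map_map, Multiset.mem_map, Finset.mem_val, Finset.mem_filter]
      rintro _ ⟨f, ⟨-, hf⟩, rfl⟩
      exact ⟨_, Multiset.mem_singleton_self _, hf⟩
  · intro f hf
    obtain ⟨p, hp, m, -, rfl⟩ := Finset.mem_image₂.1 hf
    exact coeff_zero_shiftDiff p m (hG0 q hqG)
  · intro f hf _
    obtain ⟨p, hp, m, -, rfl⟩ := Finset.mem_image₂.1 hf
    rw [Multiset.mem_add]
    rcases shiftDiff_leading m hqpos (hmin p hp) with ⟨hd, h1, h2⟩ | ⟨hd, hc, h1, h2⟩ | h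
    · refine Or.inl (Multiset.mem_map.2 ⟨(p.natDegree, p.leadingCoeff), ?_, ?_⟩)
      · exact (Multiset.mem_cons.1 (hGP p hp)).resolve_left fun h => hd (congrArg Prod.fst h)
      · simp [shift, hd, h1, h2]
    · refine Or.inl (Multiset.mem_map.2 ⟨(p.natDegree, p.leadingCoeff), ?_, ?_⟩)
      · exact (Multiset.mem_cons.1 (hGP p hp)).resolve_left fun h => hc (congrArg Prod.snd h)
      · simp [shift, hd, h1, h2]
    · exact Or.inr (Multiset.mem_map_of_mem _ (Finset.mem_filter.2 ⟨hf, h⟩))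

/-- The finitary IP polynomial van der Waerden theorem. -/
theorem ipRecurrent (x : ℕ → R) (F : Finset R[X]) (hF : ∀ f ∈ F, f.coeff 0 = 0) :
    IPRecurrent x F :=
  ipRecurrent_of_leading_mem x (F.val.map fun f => (f.natDegree, f.leadingCoeff)) F hF
    fun _ hf _ => Multiset.mem_map_of_mem _ hf

end PolynomialRecurrence

section PiecewiseSyndetic

variable {R : Type*}

/-- `T` contains a translate of every finite set. -/
def IsThickSet [Add R] (T : Set R) : Prop :=
  ∀ Q : Finset R, ∃ b, ∀ y ∈ Q, b + y ∈ T

/-- Finitely many translates of `A` cover a thick set. -/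
def IsPiecewiseSyndeticSet [Add R] (A : Set R) : Prop :=
  ∃ E : Finset R, IsThickSet {y | ∃ t ∈ E, y + t ∈ A}

open Classical in
lemma IsThickSet.piecewiseSyndetic_or_thick [AddCommSemigroup R] {T A B : Set R}
    (hT : IsThickSet T) (h : T ⊆ A ∪ B) : IsPiecewiseSyndeticSet A ∨ IsThickSet B := by
  refine or_iff_not_imp_right.2 fun hB => ?_
  simp only [IsThickSet, not_forall, not_exists] at hB
  obtain ⟨E, hE⟩ := hB
  refine ⟨E, fun Q => ?_⟩
  obtain ⟨b, hb⟩ := hT (Finset.image₂ (· + ·) Q E)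
  refine ⟨b, fun y hy => ?_⟩
  obtain ⟨t, ht, htB⟩ := hE (b + y)
  refine ⟨t, ht, (h ?_).resolve_right htB⟩
  rw [add_assoc]
  exact hb _ (Finset.mem_image₂_of_mem hy ht)

open Classical in
lemma IsThickSet.exists_piecewiseSyndetic [AddCommSemigroup R] [Nonempty R] {ι : Type*} {C : ι → Set R}
    (J : Finset ι) {T : Set R} (hT : IsThickSet T) (h : T ⊆ ⋃ i ∈ J, C i) :
    ∃ i, IsPiecewiseSyndeticSet (C i) := by
  induction J using Finset.induction_on generalizing T with
  | empty =>
    obtain ⟨y⟩ := ‹Nonempty R›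
    obtain ⟨b, hb⟩ := hT {y}
    simpa using h (hb y (by simp))
  | insert i J _ ih =>
    rw [Finset.set_biUnion_insert] at h
    rcases hT.piecewiseSyndetic_or_thick h with h | h
    · exact ⟨i, h⟩
    · exact ih h subset_rfl

open Classical in
lemma IsPiecewiseSyndeticSet.exists_forall_add_eval_mem {R : Type u} [CommRing R] {A : Set R}
    (hA : IsPiecewiseSyndeticSet A) (x : ℕ → R) (F : Finset R[X])
    (hF : ∀ f ∈ F, f.coeff 0 = 0) :
    ∃ K : Finset ℕ, K.Nonempty ∧ ∃ a, ∀ f ∈ F, a + f.eval (∑ i ∈ K, x i) ∈ A := by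
  obtain ⟨E, hE⟩ := hA
  obtain ⟨t₀, ht₀⟩ : E.Nonempty := by
    obtain ⟨b, hb⟩ := hE {0}
    obtain ⟨t, ht, -⟩ := hb 0 (by simp)
    exact ⟨t, ht⟩
  obtain ⟨Q, M, H⟩ := ipRecurrent x F hF E 0
  obtain ⟨b, hb⟩ := hE Q
  have hcol (y : R) : ∃ t : E, y ∈ Q → b + y + t ∈ A := by
    by_cases hy : y ∈ Q
    · obtain ⟨t, ht, h⟩ := hb y hy
      exact ⟨⟨t, ht⟩, fun _ => h⟩
    · exact ⟨⟨t₀, ht₀⟩, fun h => absurd h hy⟩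
  choose c hc using hcol
  obtain ⟨a, K, -, hne, s, hs⟩ := H c
  refine ⟨K, hne, b + a + s, fun f hf => ?_⟩
  obtain ⟨h1, h2⟩ := hs f hf
  have := hc _ h1
  rw [h2] at this
  convert this using 1
  ring

end PiecewiseSyndetic

/-- IP polynomial van der Waerden theorem for infinite commutative rings: for every finite
coloring there is a color class `C s` such that for every finite family `F` of polynomials
with zero constant term, `{n : ⋂_{f∈F}(-f(n)+C s) ≠ ∅}` is IP*. -/
theorem stmt_9 {R : Type*} [CommRing R] [Infinite R] (r : ℕ) (C : Fin r → Set R)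
    (hcover : (⋃ i, C i) = Set.univ) :
    ∃ s : Fin r, ∀ F : Finset (Polynomial R), (∀ f ∈ F, f.coeff 0 = 0) →
      IPStarSet {n : R | ∃ a : R, ∀ f ∈ F, a + f.eval n ∈ C s} := by
  have hT : IsThickSet (Set.univ : Set R) := fun _ => ⟨0, fun _ _ => Set.mem_univ _⟩
  obtain ⟨s, hs⟩ := hT.exists_piecewiseSyndetic (C := C) Finset.univ (by simp [hcover])
  refine ⟨s, fun F hF B hB => ?_⟩
  obtain ⟨x, hx⟩ := hB
  obtain ⟨K, hK, a, ha⟩ := hs.exists_forall_add_eval_mem x F hF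
  exact ⟨∑ n ∈ K, x n, ⟨a, ha⟩, hx K hK⟩
end

section
/- Let R be an infinite commutative ring, let A ⊆ R be piecewise syndetic in (R,+), and let F be a finite set of polynomials over R with zero constant term. Then the set {n ∈ R : ∩_{f∈F}(-f(n)+A) is piecewise syndetic in (R,+)} is an IP*-set in (R,+). -/
/-- `A` is piecewise syndetic in the commutative semigroup `(S,+)`. -/
def PiecewiseSyndetic {S : Type*} [AddCommSemigroup S] (A : Set S) : Prop :=
  ∃ G : Finset S, ∀ F : Finset S, ∃ x : S, ∀ f ∈ F, ∃ t ∈ G, t + (f + x) ∈ A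

open Polynomial

theorem PiecewiseSyndetic.mono {S : Type*} [AddCommSemigroup S] {A B : Set S}
    (hA : PiecewiseSyndetic A) (hAB : A ⊆ B) : PiecewiseSyndetic B := by
  obtain ⟨G, hG⟩ := hA
  refine ⟨G, fun H => ?_⟩
  obtain ⟨x, hx⟩ := hG H
  refine ⟨x, fun h hh => ?_⟩
  obtain ⟨t, ht, h'⟩ := hx h hh
  exact ⟨t, ht, hAB h'⟩

theorem piecewiseSyndetic_univ {S : Type*} [AddCommMonoid S] :
    PiecewiseSyndetic (Set.univ : Set S) :=
  ⟨{0}, fun _ => ⟨0, fun _ _ => ⟨0, by simp⟩⟩⟩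

theorem not_piecewiseSyndetic_empty {S : Type*} [AddCommMonoid S] :
    ¬ PiecewiseSyndetic (∅ : Set S) := by
  rintro ⟨G, hG⟩
  obtain ⟨x, hx⟩ := hG {0}
  obtain ⟨t, _, h⟩ := hx 0 (by simp)
  exact h

theorem PiecewiseSyndetic.translate {S : Type*} [AddCommGroup S] {A : Set S}
    (hA : PiecewiseSyndetic A) (c : S) : PiecewiseSyndetic {y | y + c ∈ A} := by
  obtain ⟨G, hG⟩ := hA
  refine ⟨G, fun H => ?_⟩
  obtain ⟨x, hx⟩ := hG H
  refine ⟨x - c, fun h hh => ?_⟩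
  obtain ⟨t, ht, h'⟩ := hx h hh
  refine ⟨t, ht, ?_⟩
  have : t + (h + (x - c)) + c = t + (h + x) := by abel
  simpa [this] using h'

open scoped Classical Pointwise in
/-- Piecewise syndeticity is partition regular. -/
theorem PiecewiseSyndetic.of_union {S : Type*} [AddCommGroup S] {A B : Set S}
    (h : PiecewiseSyndetic (A ∪ B)) : PiecewiseSyndetic A ∨ PiecewiseSyndetic B := by
  obtain ⟨G, hG⟩ := h
  by_cases hB : ∀ H : Finset S, ∃ x, ∀ h ∈ H, ∃ t ∈ G, t + (h + x) ∈ B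
  · exact Or.inr ⟨G, hB⟩
  · left
    push Not at hB
    obtain ⟨H, hH⟩ := hB
    refine ⟨G + H, fun F => ?_⟩
    obtain ⟨x, hx⟩ := hG (H + F)
    refine ⟨x, fun f hf => ?_⟩
    obtain ⟨h, hh, hnot⟩ := hH (f + x)
    obtain ⟨t, ht, hmem⟩ := hx (h + f) (Finset.add_mem_add hh hf)
    refine ⟨t + h, Finset.add_mem_add ht hh, ?_⟩
    have hn := hnot t ht
    rw [← add_assoc h f x] at hn
    have : t + h + (f + x) = t + (h + f + x) := by abel
    rw [this]
    exact hmem.resolve_right hn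

theorem PiecewiseSyndetic.exists_inter {S ι : Type*} [AddCommGroup S] (C : ι → Set S)
    (G : Finset ι) {B : Set S} (hB : PiecewiseSyndetic B) (hC : ∀ b ∈ B, ∃ t ∈ G, b ∈ C t) :
    ∃ t ∈ G, PiecewiseSyndetic (B ∩ C t) := by
  classical
  induction G using Finset.induction_on generalizing B with
  | empty =>
    refine absurd (hB.mono fun b hb => ?_) not_piecewiseSyndetic_empty
    simpa using hC b hb
  | insert a G _ ih =>
    rw [← Set.inter_union_sdiff B (C a)] at hB
    rcases hB.of_union with h | h
    · exact ⟨a, by simp, h⟩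
    · obtain ⟨t, ht, h'⟩ := ih h fun b hb => by
        obtain ⟨t, ht, hbt⟩ := hC b hb.1
        rcases Finset.mem_insert.1 ht with rfl | ht
        · exact absurd hbt hb.2
        · exact ⟨t, ht, hbt⟩
      exact ⟨t, Finset.mem_insert_of_mem ht, h'.mono (by gcongr; exact Set.sdiff_subset)⟩

/-- A piecewise syndetic set is modelled by a syndetic set, in the sense that piecewise
syndeticity of finite intersections of translates passes from the model to the original. -/
theorem PiecewiseSyndetic.exists_syndetic_model {S : Type*} [AddCommGroup S] {A : Set S}
    (hA : PiecewiseSyndetic A) :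
    ∃ (M : Set S) (G : Finset S), (∀ g, ∃ t ∈ G, t + g ∈ M) ∧
      ∀ V : Set S, V.Finite → PiecewiseSyndetic {y | ∀ v ∈ V, v + y ∈ M} →
        PiecewiseSyndetic {y | ∀ v ∈ V, v + y ∈ A} := by
  classical
  obtain ⟨G, hG⟩ := hA
  choose x hx using hG
  let U : Ultrafilter (Finset S) := Ultrafilter.of Filter.atTop
  have hU : (U : Filter (Finset S)) ≤ Filter.atTop := Ultrafilter.of_le _
  refine ⟨{g | ∀ᶠ H in (U : Filter (Finset S)), g + x H ∈ A}, G, fun g => ?_, fun V hV hM => ?_⟩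
  · have h1 : ∀ᶠ H in (U : Filter (Finset S)), ∃ t ∈ (G : Set S), t + (g + x H) ∈ A := by
      filter_upwards [hU (Filter.eventually_ge_atTop {g})] with H hH
      exact hx H g (hH (Finset.mem_singleton_self g))
    obtain ⟨t, ht, h⟩ := (Ultrafilter.eventually_exists_mem_iff G.finite_toSet).1 h1
    exact ⟨t, ht, by simpa [add_assoc] using h⟩
  · obtain ⟨G', hG'⟩ := hM
    refine ⟨G', fun F => ?_⟩
    obtain ⟨z, hz⟩ := hG' F
    choose! t ht hmem using hz
    have hev : ∀ᶠ H in (U : Filter (Finset S)),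
        ∀ f ∈ (F : Set S), ∀ v ∈ V, v + (t f + (f + z)) + x H ∈ A := by
      rw [Filter.eventually_all_finite F.finite_toSet]
      intro f hf
      rw [Filter.eventually_all_finite hV]
      exact fun v hv => hmem f hf v hv
    obtain ⟨H, hH⟩ := hev.exists
    refine ⟨z + x H, fun f hf => ⟨t f, ht f hf, fun v hv => ?_⟩⟩
    have : v + (t f + (f + (z + x H))) = v + (t f + (f + z)) + x H := by abel
    rw [this]
    exact hH f hf v hv

section PolynomialExhaustion

variable {R : Type*} [CommRing R]

open scoped Classical in
/-- The leading coefficients of the nonzero members of `F` of degree `d`. -/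
noncomputable def leadingCoeffsAt (F : Finset R[X]) (d : ℕ) : Finset R :=
  (F.filter fun f => f ≠ 0 ∧ f.natDegree = d).image leadingCoeff

theorem mem_leadingCoeffsAt {F : Finset R[X]} {d : ℕ} {c : R} :
    c ∈ leadingCoeffsAt F d ↔ ∃ f ∈ F, f ≠ 0 ∧ f.natDegree = d ∧ f.leadingCoeff = c := by
  simp [leadingCoeffsAt, and_assoc]

/-- The weight of a finite family of polynomials: how many leading coefficients occur in each
degree. -/
noncomputable def polyWeight (F : Finset R[X]) : ℕ →₀ ℕ :=
  Finsupp.onFinset (F.image natDegree) (fun d => (leadingCoeffsAt F d).card) fun d hd => by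
    obtain ⟨c, hc⟩ := Finset.card_ne_zero.1 hd
    obtain ⟨f, hf, -, h, -⟩ := mem_leadingCoeffsAt.1 hc
    exact Finset.mem_image.2 ⟨f, hf, h⟩

open scoped Classical in
/-- The polynomials `f(X + a) - f(a) - p(X)` for nonzero `f ∈ F` and `a ∈ Λ`. -/
noncomputable def shiftedFamily (F : Finset R[X]) (p : R[X]) (Λ : Finset R) : Finset R[X] :=
  Finset.image₂ (fun f a => taylor a f - C (f.eval a) - p) (F.erase 0) Λ

theorem mem_shiftedFamily {F : Finset R[X]} {p q : R[X]} {Λ : Finset R} :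
    q ∈ shiftedFamily F p Λ ↔
      ∃ f ∈ F, f ≠ 0 ∧ ∃ a ∈ Λ, taylor a f - C (f.eval a) - p = q := by
  simp only [shiftedFamily, Finset.mem_image₂, Finset.mem_erase]
  grind

theorem natDegree_pos_of_coeff_zero_s10 {f : R[X]} (h0 : f.coeff 0 = 0) (hf : f ≠ 0) :
    0 < f.natDegree := by
  by_contra h
  rw [eq_C_of_natDegree_eq_zero (by omega : f.natDegree = 0), h0, C_0] at hf
  exact hf rfl

theorem natDegree_taylor_sub_C (f : R[X]) (a : R) :
    (taylor a f - C (f.eval a)).natDegree = f.natDegree := by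
  rw [natDegree_sub_C, natDegree_taylor]

theorem coeff_natDegree_taylor_sub_C {f : R[X]} (hf : 0 < f.natDegree) (a : R) :
    (taylor a f - C (f.eval a)).coeff f.natDegree = f.leadingCoeff := by
  rw [coeff_sub, coeff_C_of_ne_zero hf.ne', sub_zero, ← leadingCoeff_taylor a f, leadingCoeff,
    natDegree_taylor]

/-- Shifting a family by one of its members of minimal degree lowers its weight. -/
theorem polyWeight_shiftedFamily_lt {F : Finset R[X]} (hF : ∀ f ∈ F, f.coeff 0 = 0) {p : R[X]}
    (hp : p ∈ F) (hp0 : p ≠ 0) (hmin : ∀ f ∈ F, f ≠ 0 → p.natDegree ≤ f.natDegree)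
    {Λ : Finset R} (hΛ : Λ.Nonempty) :
    Finsupp.Lex (· > ·) (· < ·) (polyWeight (shiftedFamily F p Λ)) (polyWeight F) := by
  classical
  have high : ∀ f ∈ F, f ≠ 0 → ∀ a, p.natDegree < f.natDegree →
      (taylor a f - C (f.eval a) - p).natDegree = f.natDegree ∧
      (taylor a f - C (f.eval a) - p).leadingCoeff = f.leadingCoeff := by
    intro f hf hf0 a hlt
    have hd : (taylor a f - C (f.eval a) - p).natDegree = f.natDegree := by
      rw [natDegree_sub_eq_left_of_natDegree_lt (by rwa [natDegree_taylor_sub_C]),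
        natDegree_taylor_sub_C]
    refine ⟨hd, ?_⟩
    rw [leadingCoeff, hd, coeff_sub, coeff_eq_zero_of_natDegree_lt hlt, sub_zero,
      coeff_natDegree_taylor_sub_C (natDegree_pos_of_coeff_zero_s10 (hF f hf) hf0)]
  have low : ∀ f : R[X], ∀ a, p.natDegree = f.natDegree →
      (taylor a f - C (f.eval a) - p).natDegree ≤ p.natDegree := by
    intro f a he
    exact (natDegree_sub_le _ _).trans (by rw [natDegree_taylor_sub_C, he, max_self])
  refine ⟨p.natDegree, fun d hd => ?_, ?_⟩
  · change (leadingCoeffsAt _ d).card = (leadingCoeffsAt _ d).card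
    congr 1
    ext c
    simp only [mem_leadingCoeffsAt, mem_shiftedFamily]
    constructor
    · rintro ⟨q, ⟨f, hf, hf0, a, -, rfl⟩, -, hqd, hqc⟩
      rcases (hmin f hf hf0).lt_or_eq with h | h
      · exact ⟨f, hf, hf0, (high f hf hf0 a h).1 ▸ hqd, (high f hf hf0 a h).2 ▸ hqc⟩
      · have := low f a h
        omega
    · rintro ⟨f, hf, hf0, rfl, rfl⟩
      obtain ⟨a, ha⟩ := hΛ
      obtain ⟨h1, h2⟩ := high f hf hf0 a hd
      refine ⟨_, ⟨f, hf, hf0, a, ha, rfl⟩, fun h => ?_, h1, h2⟩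
      rw [h, leadingCoeff_zero] at h2
      exact hf0 (leadingCoeff_eq_zero.1 h2.symm)
  · change (leadingCoeffsAt _ _).card < (leadingCoeffsAt _ _).card
    have hpm : p.leadingCoeff ∈ leadingCoeffsAt F p.natDegree :=
      mem_leadingCoeffsAt.2 ⟨p, hp, hp0, rfl, rfl⟩
    have hsub : leadingCoeffsAt (shiftedFamily F p Λ) p.natDegree ⊆
        ((leadingCoeffsAt F p.natDegree).erase p.leadingCoeff).image (· - p.leadingCoeff) := by
      intro c hc
      obtain ⟨q, hq, hq0, hqd, rfl⟩ := mem_leadingCoeffsAt.1 hc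
      obtain ⟨f, hf, hf0, a, -, rfl⟩ := mem_shiftedFamily.1 hq
      have he : f.natDegree = p.natDegree := by
        rcases (hmin f hf hf0).lt_or_eq with h | h
        · rw [← hqd, (high f hf hf0 a h).1]
        · exact h.symm
      have hlc : (taylor a f - C (f.eval a) - p).leadingCoeff =
          f.leadingCoeff - p.leadingCoeff := by
        rw [leadingCoeff, hqd, coeff_sub, ← he,
          coeff_natDegree_taylor_sub_C (natDegree_pos_of_coeff_zero_s10 (hF f hf) hf0), he]
        rfl
      refine Finset.mem_image.2 ⟨f.leadingCoeff, Finset.mem_erase.2 ⟨fun h => ?_, ?_⟩, hlc.symm⟩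
      · rw [h, sub_self, leadingCoeff_eq_zero] at hlc
        exact hq0 hlc
      · exact mem_leadingCoeffsAt.2 ⟨f, hf, hf0, he, rfl⟩
    exact (Finset.card_le_card hsub).trans_lt
      (Finset.card_image_le.trans_lt (Finset.card_erase_lt_of_mem hpm))

/-- The property that every piecewise syndetic set contains, piecewise syndetically often, the
configurations given by `F` along finite sums of `x` with arbitrarily large indices. -/
def RecurrentAlong (x : ℕ → R) (F : Finset R[X]) : Prop :=
  ∀ (m : ℕ) (A : Set R), PiecewiseSyndetic A → ∃ K : Finset ℕ, K.Nonempty ∧ (∀ k ∈ K, m ≤ k) ∧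
    PiecewiseSyndetic {y | ∀ f ∈ F, f.eval (∑ n ∈ K, x n) + y ∈ A}

/-- Colour focusing: given a finite cover `C` of `R`, one can focus on more and more colours until
one of them is repeated. -/
theorem exists_focused_s10 (x : ℕ → R) {F : Finset R[X]} (hF : ∀ f ∈ F, f.coeff 0 = 0)
    {p : R[X]} (ih : ∀ Λ : Finset R, Λ.Nonempty → RecurrentAlong x (shiftedFamily F p Λ)) (m : ℕ)
    (G : Finset R) (C : R → Set R) (hC : ∀ b, ∃ t ∈ G, b ∈ C t) (k : ℕ) :
    (∃ t ∈ G, ∃ K : Finset ℕ, K.Nonempty ∧ (∀ k ∈ K, m ≤ k) ∧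
      PiecewiseSyndetic {y | ∀ f ∈ F, f.eval (∑ n ∈ K, x n) + y ∈ C t}) ∨
    ∃ Θ ⊆ G, Θ.card = k ∧ ∃ B : Set R, PiecewiseSyndetic B ∧ ∀ t ∈ Θ, ∃ K : Finset ℕ,
      K.Nonempty ∧ (∀ k ∈ K, m ≤ k) ∧
        ∀ b ∈ B, ∀ f ∈ F, f ≠ 0 → f.eval (∑ n ∈ K, x n) + b ∈ C t := by
  classical
  induction k with
  | zero => exact Or.inr ⟨∅, by simp, rfl, Set.univ, piecewiseSyndetic_univ, by simp⟩
  | succ k hk =>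
    rcases hk with hk | ⟨Θ, hΘ, hcard, B, hB, hfoc⟩
    · exact Or.inl hk
    obtain ⟨t₀, ht₀, hB₀⟩ := hB.exists_inter C G fun b _ => hC b
    choose! K hKne hKm hK using hfoc
    by_cases hmem : t₀ ∈ Θ
    · refine Or.inl ⟨t₀, ht₀, K t₀, hKne _ hmem, hKm _ hmem, hB₀.mono fun b hb f hf => ?_⟩
      by_cases hf0 : f = 0
      · simpa [hf0] using hb.2
      · exact hK _ hmem b hb.1 f hf hf0
    right
    obtain ⟨K', hne, hge, hPS⟩ := ih (insert 0 (Θ.image fun t => ∑ n ∈ K t, x n)) (by simp)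
      (max m ((Θ.biUnion K).sup id + 1)) _ hB₀
    have hdisj : ∀ t ∈ Θ, Disjoint K' (K t) := by
      intro t ht
      rw [Finset.disjoint_left]
      intro n hn hn'
      have h1 := hge n hn
      have h2 : id n ≤ (Θ.biUnion K).sup id :=
        Finset.le_sup (Finset.mem_biUnion.2 ⟨t, ht, hn'⟩)
      simp only [id] at h2
      omega
    have hm : ∀ n ∈ K', m ≤ n := fun n hn => (le_max_left _ _).trans (hge n hn)
    have hmain : ∀ a ∈ insert 0 (Θ.image fun t => ∑ n ∈ K t, x n), ∀ b,
        (∀ q ∈ shiftedFamily F p (insert 0 (Θ.image fun t => ∑ n ∈ K t, x n)),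
          q.eval (∑ n ∈ K', x n) + (b + p.eval (∑ n ∈ K', x n)) ∈ B ∩ C t₀) →
        ∀ f ∈ F, f ≠ 0 →
          f.eval (∑ n ∈ K', x n + a) - f.eval a + b ∈ B ∩ C t₀ := by
      intro a ha b hb f hf hf0
      have := hb _ (mem_shiftedFamily.2 ⟨f, hf, hf0, a, ha, rfl⟩)
      simp only [eval_sub, eval_C, taylor_eval] at this
      convert this using 1
      ring
    refine ⟨insert t₀ Θ, Finset.insert_subset ht₀ hΘ, by
      rw [Finset.card_insert_of_notMem hmem, hcard], _,
      hPS.translate (p.eval (∑ n ∈ K', x n)), fun t ht => ?_⟩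
    rcases Finset.mem_insert.1 ht with rfl | ht
    · refine ⟨K', hne, hm, fun b hb f hf hf0 => ?_⟩
      have h1 := hmain 0 (Finset.mem_insert_self _ _) b hb f hf hf0
      rw [add_zero, ← coeff_zero_eq_eval_zero, hF f hf, sub_zero] at h1
      exact h1.2
    · refine ⟨K' ∪ K t, hne.mono Finset.subset_union_left, fun n hn => ?_,
        fun b hb f hf hf0 => ?_⟩
      · rcases Finset.mem_union.1 hn with h | h
        · exact hm n h
        · exact hKm t ht n h
      · rw [Finset.sum_union (hdisj t ht)]
        have h1 := hmain (∑ n ∈ K t, x n)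
          (Finset.mem_insert_of_mem (Finset.mem_image_of_mem _ ht)) b hb f hf hf0
        convert hK t ht _ h1.1 f hf hf0 using 1
        ring

theorem recurrentAlong (x : ℕ → R) (F : Finset R[X]) (hF : ∀ f ∈ F, f.coeff 0 = 0) :
    RecurrentAlong x F := by
  classical
  have wf : WellFounded (Finsupp.Lex (α := ℕ) (N := ℕ) (· > ·) (· < ·)) :=
    Finsupp.Lex.wellFounded' (fun n => n.not_lt_zero) wellFounded_lt wellFounded_lt
  induction F using (InvImage.wf polyWeight wf).induction with
  | _ F ih =>
  intro m A hA
  by_cases hne : (F.erase 0).Nonempty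
  · obtain ⟨p, hp, hmin⟩ := (F.erase 0).exists_min_image natDegree hne
    rw [Finset.mem_erase] at hp
    have ih' : ∀ Λ : Finset R, Λ.Nonempty → RecurrentAlong x (shiftedFamily F p Λ) := by
      intro Λ hΛ
      refine ih _ (polyWeight_shiftedFamily_lt hF hp.2 hp.1
        (fun f hf hf0 => hmin f (Finset.mem_erase.2 ⟨hf0, hf⟩)) hΛ) fun q hq => ?_
      obtain ⟨f, hf, -, a, -, rfl⟩ := mem_shiftedFamily.1 hq
      simp [taylor_coeff_zero, hF p hp.2]
    obtain ⟨M, G, hG, hM⟩ := hA.exists_syndetic_model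
    rcases exists_focused_s10 x hF ih' m G (fun t => {y | t + y ∈ M}) hG (G.card + 1) with
      ⟨t, -, K, hK, hKm, h⟩ | ⟨Θ, hΘ, hcard, -⟩
    · refine ⟨K, hK, hKm, ?_⟩
      have := hM ((fun f : R[X] => f.eval (∑ n ∈ K, x n)) '' F) (F.finite_toSet.image _)
        ((h.translate (-t)).mono fun y hy => ?_)
      · simpa using this
      · rintro _ ⟨f, hf, rfl⟩
        have h1 := hy f hf
        simp only [Set.mem_ofPred_eq] at h1
        convert h1 using 1
        ring
    · have := Finset.card_le_card hΘ
      omega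
  · refine ⟨{m}, by simp, by simp, hA.mono fun y hy f hf => ?_⟩
    have : f = 0 := by
      by_contra h0
      exact hne ⟨f, Finset.mem_erase.2 ⟨h0, hf⟩⟩
    simpa [this] using hy

end PolynomialExhaustion

/-- Strong IP polynomial van der Waerden theorem: if `A` is piecewise syndetic in an infinite
commutative ring and `F` is a finite set of polynomials with zero constant term, then
`{n : ⋂_{f∈F}(-f(n)+A) is piecewise syndetic}` is IP*. -/
theorem stmt_10 {R : Type*} [CommRing R] [Infinite R] (A : Set R)
    (hA : PiecewiseSyndetic A) (F : Finset (Polynomial R)) (hF : ∀ f ∈ F, f.coeff 0 = 0) :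
    IPStarSet {n : R | PiecewiseSyndetic {y : R | ∀ f ∈ F, f.eval n + y ∈ A}} := by
  rintro B ⟨x, hx⟩
  obtain ⟨K, hK, -, h⟩ := recurrentAlong x F hF 0 A hA
  exact ⟨_, h, hx K hK⟩
end
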